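/- Let n be even and let y : S^{n−2} → ℝ^n be a continuous map such that for each x̃ ∈ S^{n−2}, the vector y(x̃) is Lorentz-orthogonal to x = (x̃, 1). Then there exists x̃ ∈ S^{n−2} and k ∈ ℝ such that y(x̃) = k · (x̃, 1). -/

import Mathlib

/-- The standard Lorentzian scalar product on `ℝ^n = (Fin (n-1) → ℝ) × ℝ`,
positive on the first `n-1` coordinates and negative on the last one. -/
def lorentzProd6 {m : ℕ} (u v : (Fin m → ℝ) × ℝ) : ℝ :=
  (∑ i, u.1 i * v.1 i) - u.2 * v.2

section HairyBall
open MeasureTheory Polynomial Metric Set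
open scoped NNReal

theorem hb_poly (P : ℝ[X]) (c t0 : ℝ) (hc : 0 < c) (ht0 : 0 < t0) (m : ℕ) (hm : Odd m)
    (h : ∀ t ∈ Ioo 0 t0, P.eval t = c * (Real.sqrt (1 + t ^ 2)) ^ m) : False := by
  have h1 : P ^ 2 = C (c ^ 2) * (1 + X ^ 2) ^ m := by
    apply Polynomial.eq_of_infinite_eval_eq
    apply Set.Infinite.mono _ (Ioo_infinite ht0)
    intro t ht
    have : (Real.sqrt (1 + t ^ 2)) ^ 2 = 1 + t ^ 2 := Real.sq_sqrt (by positivity)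
    simp only [mem_ofPred_eq, eval_pow, eval_mul, eval_C, eval_add, eval_one, eval_X, h t ht]
    rw [mul_pow, ← pow_mul, mul_comm m 2, pow_mul, this]
  have h2 : (P.map (algebraMap ℝ ℂ)) ^ 2
      = C ((c : ℂ) ^ 2) * ((X - C Complex.I) ^ m * (X - C (-Complex.I)) ^ m) := by
    have := congrArg (Polynomial.map (algebraMap ℝ ℂ)) h1
    simp only [Polynomial.map_pow, Polynomial.map_mul, Polynomial.map_add, map_C, map_X,
      Polynomial.map_one] at this
    rw [this, ← mul_pow]
    congr 2
    · simp
    · have : (C Complex.I : ℂ[X]) * C Complex.I = -1 := by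
        rw [← C_mul, Complex.I_mul_I]; simp
      rw [C_neg]
      linear_combination this
  have hc' : (C ((c : ℂ) ^ 2) : ℂ[X]) ≠ 0 := by
    simp [hc.ne']
  have n1 : (X - C Complex.I : ℂ[X]) ^ m ≠ 0 := pow_ne_zero _ (X_sub_C_ne_zero _)
  have n2 : (X - C (-Complex.I) : ℂ[X]) ^ m ≠ 0 := pow_ne_zero _ (X_sub_C_ne_zero _)
  have h3 := congrArg (rootMultiplicity Complex.I) h2
  have hP : (P.map (algebraMap ℝ ℂ)) ^ 2 ≠ 0 := by
    rw [h2]; exact mul_ne_zero hc' (mul_ne_zero n1 n2)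
  rw [rootMultiplicity_mul (mul_ne_zero hc' (mul_ne_zero n1 n2)),
    rootMultiplicity_mul (mul_ne_zero n1 n2), rootMultiplicity_C, rootMultiplicity_X_sub_C_pow,
    pow_two, rootMultiplicity_mul (by rwa [← pow_two])] at h3
  have h4 : rootMultiplicity Complex.I ((X - C (-Complex.I) : ℂ[X]) ^ m) = 0 := by
    apply rootMultiplicity_eq_zero
    simp only [IsRoot, eval_pow, eval_sub, eval_X, eval_C]
    apply pow_ne_zero
    rw [sub_neg_eq_add, ← two_mul]
    simp
  rw [h4] at h3
  obtain ⟨k, hk⟩ := hm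
  omega

theorem hb_det {E : Type*} [NormedAddCommGroup E] [InnerProductSpace ℝ E] [FiniteDimensional ℝ E]
    (A : E →L[ℝ] E) : ∃ Q : ℝ[X], Q.natDegree ≤ Module.finrank ℝ E ∧
      ∀ t : ℝ, Q.eval t = (ContinuousLinearMap.id ℝ E + t • A).det := by
  let b := Module.finBasis ℝ E
  let M := LinearMap.toMatrix b b (A : E →ₗ[ℝ] E)
  refine ⟨Matrix.det ((X : ℝ[X]) • M.map C + (1 : Matrix _ _ ℝ).map C), ?_, fun t => ?_⟩
  · simpa using Polynomial.natDegree_det_X_add_C_le M 1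
  · rw [← Polynomial.coe_evalRingHom, RingHom.map_det]
    rw [ContinuousLinearMap.det, ← LinearMap.det_toMatrix b]
    congr 1
    have : ((ContinuousLinearMap.id ℝ E + t • A : E →L[ℝ] E) : E →ₗ[ℝ] E)
      = LinearMap.id + t • (A : E →ₗ[ℝ] E) := rfl
    rw [this, map_add (LinearMap.toMatrix b b), map_smul (LinearMap.toMatrix b b), LinearMap.toMatrix_id]
    ext i j
    by_cases hij : i = j
    · simp [M, Matrix.one_apply, hij]; ring
    · simp [M, Matrix.one_apply, hij]; ring

theorem hb_core {E : Type*} [NormedAddCommGroup E] [InnerProductSpace ℝ E] [FiniteDimensional ℝ E]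
    (hodd : Odd (Module.finrank ℝ E)) (u : E → E) (K : ℝ≥0) (hK : LipschitzWith K u)
    (hd : ∀ x, x ≠ 0 → DifferentiableAt ℝ u x)
    (hn : ∀ (t : ℝ) x, ‖x + t • u x‖ = Real.sqrt (1 + t ^ 2) * ‖x‖) : False := by
  borelize E
  let μ : Measure E := Measure.addHaar
  have : Nontrivial E := Module.nontrivial_of_finrank_pos (R := ℝ) hodd.pos
  set m := Module.finrank ℝ E with hm
  let s : Set E := ball 0 1 \ {0}
  have hs : MeasurableSet s := measurableSet_ball.diff (measurableSet_singleton 0)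
  have hsfin : μ s ≠ ⊤ := (measure_mono sdiff_subset |>.trans_lt measure_ball_lt_top).ne
  let D : ℝ → E → ℝ := fun t x => (ContinuousLinearMap.id ℝ E + t • fderiv ℝ u x).det
  have hdet : Continuous fun f : E →L[ℝ] E => f.det := ContinuousLinearMap.continuous_det
  -- integrability
  have hint : ∀ t, IntegrableOn (D t) s μ := by
    intro t
    have hcont : Continuous fun A : E →L[ℝ] E => (ContinuousLinearMap.id ℝ E + t • A).det :=
      hdet.comp (by fun_prop)
    obtain ⟨B, hB⟩ := (isCompact_closedBall (0 : E →L[ℝ] E) K).exists_bound_of_continuousOn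
      hcont.continuousOn
    refine Measure.integrableOn_of_bounded hsfin (M := B) ?_ ?_
    · exact (hcont.measurable.comp (measurable_fderiv ℝ u)).aestronglyMeasurable
    · refine Filter.Eventually.of_forall fun x => hB _ ?_
      simpa using norm_fderiv_le_of_lipschitz ℝ hK
  -- positivity
  obtain ⟨ε, hε, hpos⟩ : ∃ ε > 0, ∀ A : E →L[ℝ] E, ‖A‖ < ε →
      0 < (ContinuousLinearMap.id ℝ E + A).det := by
    have h1 : ContinuousAt (fun A : E →L[ℝ] E => (ContinuousLinearMap.id ℝ E + A).det) 0 :=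
      (hdet.comp (by fun_prop)).continuousAt
    have h2 : (0:ℝ) < (ContinuousLinearMap.id ℝ E + 0).det := by
      simp [ContinuousLinearMap.det]
    obtain ⟨ε, hε, h⟩ := Metric.eventually_nhds_iff.1 (h1.eventually (lt_mem_nhds h2))
    exact ⟨ε, hε, fun A hA => h (by simpa using hA)⟩
  -- interpolation
  obtain ⟨P, hP⟩ : ∃ P : ℝ[X], ∀ t, P.eval t = ∫ x in s, D t x ∂μ := by
    let v : Fin (m + 1) → ℝ := fun i => (i : ℕ)
    have hv : Set.InjOn v (Finset.univ : Finset (Fin (m + 1))) := by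
      intro i _ j _ h
      simpa [v, Fin.ext_iff] using h
    have key : ∀ t x, D t x = ∑ i, D (v i) x * (Lagrange.basis Finset.univ v i).eval t := by
      intro t x
      obtain ⟨Q, hQ, hQe⟩ := hb_det (fderiv ℝ u x)
      have := Lagrange.eq_interpolate (f := Q) hv (by
        refine lt_of_le_of_lt degree_le_natDegree ?_
        simp only [Finset.card_univ, Fintype.card_fin]
        exact_mod_cast Nat.lt_succ_of_le hQ)
      have h2 := congrArg (eval t) this
      rw [hQe] at h2
      simp only [D]
      rw [h2, Lagrange.interpolate_apply, eval_finsetSum]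
      simp [hQe]
    refine ⟨∑ i, C (∫ x in s, D (v i) x ∂μ) * Lagrange.basis Finset.univ v i, fun t => ?_⟩
    simp_rw [key t]
    rw [integral_finsetSum _ (fun i _ => (hint (v i)).mul_const _), eval_finsetSum]
    refine Finset.sum_congr rfl fun i _ => ?_
    rw [integral_mul_const]
    simp
  have hKp : (0:ℝ) < K + 1 := by positivity
  refine hb_poly P (μ.real (ball 0 1)) (min (ε / (K + 1)) (1 / (K + 1))) ?_ (by positivity) m hodd ?_
  · exact ENNReal.toReal_pos (measure_ball_pos μ 0 one_pos).ne' measure_ball_lt_top.ne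
  rintro t ⟨ht, ht'⟩
  obtain ⟨ht1, ht2⟩ := lt_min_iff.1 ht'
  rw [lt_div_iff₀ hKp] at ht1 ht2
  set r := Real.sqrt (1 + t ^ 2) with hr
  have hrp : 0 < r := Real.sqrt_pos.2 (by positivity)
  let f : E → E := fun x => x + t • u x
  have hfl : ApproximatesLinearOn f ((ContinuousLinearEquiv.refl ℝ E : E ≃L[ℝ] E) : E →L[ℝ] E) univ
      (Real.toNNReal t * K) := by
    intro x _ y _
    have := hK.dist_le_mul x y
    have e : f x - f y - ((ContinuousLinearEquiv.refl ℝ E : E ≃L[ℝ] E) : E →L[ℝ] E) (x - y)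
        = t • (u x - u y) := by
      simp only [f, ContinuousLinearEquiv.coe_refl, ContinuousLinearMap.coe_id', id, smul_sub]
      abel
    rw [e, norm_smul, Real.norm_eq_abs, abs_of_pos ht, NNReal.coe_mul, Real.coe_toNNReal _ ht.le,
      mul_assoc]
    rw [dist_eq_norm, dist_eq_norm] at this
    gcongr
  have hcn : Real.toNNReal t * K < ‖((ContinuousLinearEquiv.refl ℝ E).symm : E →L[ℝ] E)‖₊⁻¹ := by
    have : ‖((ContinuousLinearEquiv.refl ℝ E).symm : E →L[ℝ] E)‖₊ = 1 := by
      apply NNReal.eq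
      exact ContinuousLinearMap.norm_id
    rw [this, inv_one, ← NNReal.coe_lt_coe, NNReal.coe_mul, Real.coe_toNNReal _ ht.le]
    push_cast
    nlinarith
  have hinj : Function.Injective f := by
    have := hfl.injOn (Or.inr hcn)
    rwa [Set.injOn_univ] at this
  have hsurj : Function.Surjective f := hfl.surjective (Or.inr hcn)
  have him : f '' s = ball 0 r \ {0} := by
    have hmem : ∀ x, f x ∈ ball (0:E) r \ {0} ↔ x ∈ s := by
      intro x
      have h1 : ‖f x‖ = r * ‖x‖ := hn t x
      have h2 : f x = 0 ↔ x = 0 := by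
        rw [← norm_eq_zero, h1, mul_eq_zero, norm_eq_zero]; simp [hrp.ne']
      have h3 : r * ‖x‖ < r ↔ ‖x‖ < 1 := by
        constructor <;> intro h <;> nlinarith
      simp [s, h1, h2, h3]
    ext z
    obtain ⟨x, rfl⟩ := hsurj z
    rw [hmem, hinj.mem_set_image]
  have hcv := integral_image_eq_integral_abs_det_fderiv_smul μ (s := s) (f := f)
    (f' := fun x => ContinuousLinearMap.id ℝ E + t • fderiv ℝ u x) hs
    (fun x hx => ((hasFDerivAt_id x).add
      ((hd x hx.2).hasFDerivAt.const_smul t)).hasFDerivWithinAt) hinj.injOn (fun _ => (1:ℝ))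
  have hDp : ∀ x, 0 < D t x := by
    intro x
    apply hpos
    rw [norm_smul, Real.norm_eq_abs, abs_of_pos ht]
    have := norm_fderiv_le_of_lipschitz ℝ hK (x₀ := x)
    nlinarith
  have e1 : ∫ x in s, |(ContinuousLinearMap.id ℝ E + t • fderiv ℝ u x).det| • (1:ℝ) ∂μ
      = ∫ x in s, D t x ∂μ := by
    congr 1
    ext x
    rw [smul_eq_mul, mul_one]
    exact abs_of_pos (hDp x)
  rw [hP, ← e1, ← hcv, him]
  simp only [integral_const, smul_eq_mul, mul_one]
  rw [measureReal_restrict_apply_univ, measureReal_def, measure_sdiff_null (measure_singleton 0),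
    Measure.addHaar_ball_of_pos μ 0 hrp, ENNReal.toReal_mul, ENNReal.toReal_ofReal (by positivity),
    mul_comm]
  rfl

theorem hb_main {E : Type*} [NormedAddCommGroup E] [InnerProductSpace ℝ E] [FiniteDimensional ℝ E]
    (hodd : Odd (Module.finrank ℝ E)) (v : E → E) (hv : ContinuousOn v (sphere 0 1))
    (hvt : ∀ x ∈ sphere (0 : E) 1, inner ℝ x (v x) = 0) : ∃ x ∈ sphere (0 : E) 1, v x = 0 := by
  by_contra! hne
  let T : E → Set E := fun y => {w | y ∈ sphere (0 : E) 1 → 0 < inner ℝ (v y) w}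
  have hT : ∀ y, Convex ℝ (T y) := by
    intro y a ha b hb r s hr hs hrs hy
    have h1 := ha hy
    have h2 := hb hy
    rw [inner_add_right, inner_smul_right, inner_smul_right]
    rcases hr.eq_or_lt with rfl | hr
    · have : s = 1 := by linarith
      subst this; simpa using h2
    · have := mul_pos hr h1
      have := mul_nonneg hs h2.le
      linarith
  obtain ⟨g, hg⟩ := exists_contMDiffMap_forall_mem_convex_of_local_const (n := 1)
      (modelWithCornersSelf ℝ E) hT (by
    intro x
    by_cases hx : x ∈ sphere (0 : E) 1
    · refine ⟨v x, ?_⟩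
      have hc : ContinuousWithinAt (fun y => (inner ℝ (v y) (v x) : ℝ)) (sphere 0 1) x :=
        (hv x hx).inner continuousWithinAt_const
      have hp : (0:ℝ) < inner ℝ (v x) (v x) := by
        rw [real_inner_self_eq_norm_sq]
        have := norm_pos_iff.2 (hne x hx)
        positivity
      exact eventually_nhdsWithin_iff.1 (hc.eventually (lt_mem_nhds hp))
    · refine ⟨0, ?_⟩
      filter_upwards [isClosed_sphere.isOpen_compl.mem_nhds hx] with y hy hy'
      exact absurd hy' hy)
  have hgc : ContDiff ℝ 1 g := g.contMDiff.contDiff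
  let p : E → E := fun x => g x - (inner ℝ x (g x) : ℝ) • x
  have hp : ContDiff ℝ 1 p := hgc.sub ((contDiff_id.inner ℝ hgc).smul contDiff_id)
  have hpx : ∀ x ∈ sphere (0 : E) 1, inner ℝ x (p x) = 0 := by
    intro x hx
    have : ‖x‖ = 1 := by simpa using hx
    simp [p, inner_sub_right, inner_smul_right, this]
  have hp0 : ∀ x ∈ sphere (0 : E) 1, p x ≠ 0 := by
    intro x hx h0
    have h1 : inner ℝ (v x) (p x) = inner ℝ (v x) (g x) := by
      simp [p, inner_sub_right, inner_smul_right, real_inner_comm x (v x), hvt x hx]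
    have h2 := hg x hx
    rw [h0, inner_zero_right] at h1
    linarith
  let q : E → E := fun x => ‖p x‖⁻¹ • p x
  have hq : ∀ x ∈ sphere (0 : E) 1, ContDiffAt ℝ 1 q x := by
    intro x hx
    exact ((hp.contDiffAt.norm ℝ (hp0 x hx)).inv (norm_ne_zero_iff.2 (hp0 x hx))).smul
      hp.contDiffAt
  have hqn : ∀ x ∈ sphere (0 : E) 1, ‖q x‖ = 1 := by
    intro x hx
    have := norm_ne_zero_iff.2 (hp0 x hx)
    simp [q, norm_smul, this]
  have hqi : ∀ x ∈ sphere (0 : E) 1, inner ℝ x (q x) = 0 := by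
    intro x hx
    simp [q, inner_smul_right, hpx x hx]
  obtain ⟨K, hK⟩ : ∃ K, LipschitzOnWith K q (sphere 0 1) := by
    apply LocallyLipschitzOn.exists_lipschitzOnWith_of_compact (isCompact_sphere 0 1)
    intro x hx
    obtain ⟨K, t, ht, h⟩ := (hq x hx).exists_lipschitzOnWith
    exact ⟨K, t, mem_nhdsWithin_of_mem_nhds ht, h⟩
  let N : E → E := fun x => ‖x‖⁻¹ • x
  have hN : ∀ x, x ≠ 0 → N x ∈ sphere (0 : E) 1 := by
    intro x hx
    have := norm_ne_zero_iff.2 hx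
    simp [N, norm_smul, this]
  have hNx : ∀ x, ‖x‖ • N x = x := by
    intro x
    by_cases hx : x = 0
    · simp [hx]
    · simp [N, smul_smul, norm_ne_zero_iff.2 hx]
  let u : E → E := fun x => ‖x‖ • q (N x)
  have hun : ∀ x, ‖u x‖ = ‖x‖ := by
    intro x
    by_cases hx : x = 0
    · simp [u, hx]
    · simp [u, norm_smul, hqn _ (hN x hx)]
  have hu0 : u 0 = 0 := by simp [u]
  have hui : ∀ x, inner ℝ x (u x) = 0 := by
    intro x
    by_cases hx : x = 0
    · simp [hx]
    · have := hqi _ (hN x hx)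
      have e : inner ℝ (‖x‖ • N x) (u x) = 0 := by
        rw [real_inner_smul_left]
        simp only [u]
        rw [real_inner_smul_right, this]
        simp
      rwa [hNx] at e
  refine hb_core hodd u (1 + 2 * K) ?_ ?_ ?_
  · apply LipschitzWith.of_dist_le_mul
    intro x y
    rw [dist_eq_norm, dist_eq_norm]
    push_cast
    have hK0 : (0:ℝ) ≤ K := K.2
    by_cases hx : x = 0
    · rw [hx, hu0, zero_sub, zero_sub, norm_neg, norm_neg, hun]
      nlinarith [norm_nonneg y]
    by_cases hy : y = 0
    · rw [hy, hu0, sub_zero, sub_zero, hun]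
      nlinarith [norm_nonneg x]
    have hxy : |‖x‖ - ‖y‖| ≤ ‖x - y‖ := abs_norm_sub_norm_le x y
    have hnx : ‖N x‖ = 1 := by simpa using hN x hx
    have e1 : u x - u y = (‖x‖ - ‖y‖) • q (N x) + ‖y‖ • (q (N x) - q (N y)) := by
      simp only [u, sub_smul, smul_sub]; abel
    have e2 : ‖y‖ • (N x - N y) = (x - y) - (‖x‖ - ‖y‖) • N x := by
      rw [smul_sub, sub_smul, hNx, hNx]; abel
    have h2 : ‖y‖ * ‖N x - N y‖ ≤ 2 * ‖x - y‖ := by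
      have : ‖y‖ * ‖N x - N y‖ = ‖‖y‖ • (N x - N y)‖ := by rw [norm_smul, norm_norm]
      rw [this, e2]
      refine (norm_sub_le _ _).trans ?_
      rw [norm_smul, hnx, Real.norm_eq_abs]
      linarith
    have h3 : ‖q (N x) - q (N y)‖ ≤ K * ‖N x - N y‖ := by
      simpa [dist_eq_norm] using hK.dist_le_mul _ (hN x hx) _ (hN y hy)
    rw [e1]
    refine (norm_add_le _ _).trans ?_
    rw [norm_smul, hqn _ (hN x hx), norm_smul, Real.norm_eq_abs, norm_norm]
    have h4 := mul_le_mul_of_nonneg_left h3 (norm_nonneg y)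
    have h5 := mul_le_mul_of_nonneg_left h2 hK0
    linarith
  · intro x hx
    have hn : DifferentiableAt ℝ (fun x : E => ‖x‖) x := differentiableAt_id.norm ℝ hx
    have hNd : DifferentiableAt ℝ N x := (hn.inv (norm_ne_zero_iff.2 hx)).smul differentiableAt_id
    exact hn.smul (((hq _ (hN x hx)).differentiableAt one_ne_zero).comp x hNd)
  · intro t x
    have : ‖x + t • u x‖ ^ 2 = (1 + t ^ 2) * ‖x‖ ^ 2 := by
      rw [norm_add_sq_real, inner_smul_right, hui, norm_smul, hun, mul_pow, Real.norm_eq_abs, sq_abs]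
      ring
    rw [← Real.sqrt_sq (norm_nonneg (x + t • u x)), this, Real.sqrt_mul (by positivity),
      Real.sqrt_sq (norm_nonneg x)]

end HairyBall

/-- Let `n ≥ 2` be even and `y : S^{n-2} → ℝ^n` continuous such that for
each `x̃` in the unit sphere `S^{n-2} ⊂ ℝ^{n-1}`, the vector `y(x̃)` is Lorentz-orthogonal
to the null vector `x = (x̃, 1)`. Then there exist `x̃ ∈ S^{n-2}` and `k ∈ ℝ` with
`y(x̃) = k • (x̃, 1)`. -/
theorem exists_proportional_of_lorentz_orthogonal_field (n : ℕ) (hn : Even n) (hn2 : 2 ≤ n)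
    (y : (Fin (n - 1) → ℝ) → (Fin (n - 1) → ℝ) × ℝ)
    (hcont : ContinuousOn y {xt | ∑ i, xt i ^ 2 = 1})
    (horth : ∀ xt : Fin (n - 1) → ℝ, (∑ i, xt i ^ 2 = 1) →
      lorentzProd6 (y xt) (xt, 1) = 0) :
    ∃ xt : Fin (n - 1) → ℝ, (∑ i, xt i ^ 2 = 1) ∧
      ∃ k : ℝ, y xt = k • ((xt, 1) : (Fin (n - 1) → ℝ) × ℝ) := by
  have hodd : Odd (Module.finrank ℝ (EuclideanSpace ℝ (Fin (n - 1)))) := by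
    rw [finrank_euclideanSpace_fin]
    exact Nat.Even.sub_odd (by omega) hn odd_one
  have hsph : ∀ x : EuclideanSpace ℝ (Fin (n - 1)), x ∈ Metric.sphere 0 1 ↔
      ∑ i, x.ofLp i ^ 2 = 1 := by
    intro x
    rw [mem_sphere_zero_iff_norm, EuclideanSpace.norm_eq, Real.sqrt_eq_one]
    simp
  have hy : ContinuousOn (fun x : EuclideanSpace ℝ (Fin (n - 1)) => y x.ofLp)
      (Metric.sphere 0 1) :=
    hcont.comp (PiLp.continuous_ofLp 2 _).continuousOn (fun x hx => (hsph x).1 hx)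
  obtain ⟨x, hx, hx0⟩ := hb_main hodd
    (fun x => WithLp.toLp 2 (y x.ofLp).1 - (y x.ofLp).2 • x)
    (((PiLp.continuous_toLp 2 _).comp_continuousOn hy.fst).sub (hy.snd.smul continuousOn_id)) (by
      intro x hx
      have h1 := horth _ ((hsph x).1 hx)
      have h2 : ‖x‖ = 1 := by simpa using hx
      simp only [lorentzProd6, mul_one] at h1
      rw [inner_sub_right, inner_smul_right, real_inner_self_eq_norm_sq, h2]
      simpa [PiLp.inner_apply] using h1)
  refine ⟨x.ofLp, (hsph x).1 hx, (y x.ofLp).2, ?_⟩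
  have h3 := congrArg WithLp.ofLp (sub_eq_zero.1 hx0)
  ext1
  · simpa using h3
  · simp
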